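/- arXiv:1405.0367 — 6 statements merged into one kernel-verified Lean document; each statement's English description precedes it below -/
import Mathlib

section
/- Let ω₀ ∈ (0, π) and t ∈ ℂ. A number λ ∈ ℂ is an eigenvalue of the nonlocal model problem, i.e., there exists a twice continuously differentiable function φ : ℝ → ℂ, not identically zero on [−ω₀, ω₀], such that φ''(ω) = λ²·φ(ω) for all ω ∈ [−ω₀, ω₀], φ(−ω₀) = (1 + t)·φ(0) and φ(ω₀) = (1 − t)·φ(0), if and only if λ = (π k/ω₀)·i for some integer k. In particular, the set of eigenvalues does not depend on t. -/
open Set Complex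

lemma aux_exp (a : ℂ) (x : ℝ) :
    HasDerivAt (fun y : ℝ => Complex.exp (a * y)) (Complex.exp (a * x) * a) x := by
  have h1 : HasDerivAt (fun y : ℝ => a * (y : ℂ)) a x := by
    simpa using (Complex.ofRealCLM.hasDerivAt (x := x)).const_mul a
  exact h1.cexp

lemma aux_const (ω₀ : ℝ) (lam : ℂ) (φ : ℝ → ℂ) (hφ : ContDiff ℝ 2 φ)
    (h : ∀ ω ∈ Set.Icc (-ω₀) ω₀, iteratedDeriv 2 φ ω = lam ^ 2 * φ ω) :
    ∃ c : ℂ, ∀ ω ∈ Set.Icc (-ω₀) ω₀, deriv φ ω + lam * φ ω = c * Complex.exp (lam * ω) := by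
  have d1 : ∀ x, HasDerivAt φ (deriv φ x) x := fun x =>
    (hφ.differentiable (by norm_num) x).hasDerivAt
  have hφ' : ContDiff ℝ 1 (deriv φ) := by
    have : ContDiff ℝ (1 + 1) φ := by simpa [one_add_one_eq_two] using hφ
    exact (contDiff_succ_iff_deriv.1 this).2.2
  have d2 : ∀ x, HasDerivAt (deriv φ) (iteratedDeriv 2 φ x) x := fun x => by
    have := (hφ'.differentiable (by norm_num) x).hasDerivAt
    rwa [show iteratedDeriv 2 φ = deriv (deriv φ) by
      rw [iteratedDeriv_succ, iteratedDeriv_one]]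
  have d3 : ∀ x, HasDerivAt (fun y : ℝ => (deriv φ y + lam * φ y) * Complex.exp (-lam * y))
      ((iteratedDeriv 2 φ x + lam * deriv φ x) * Complex.exp (-lam * x) +
        (deriv φ x + lam * φ x) * (Complex.exp (-lam * x) * -lam)) x := fun x =>
    ((d2 x).add ((d1 x).const_mul lam)).mul (aux_exp (-lam) x)
  have key := constant_of_has_deriv_right_zero
    (f := fun y : ℝ => (deriv φ y + lam * φ y) * Complex.exp (-lam * y)) (a := -ω₀) (b := ω₀)
    (fun x _ => (d3 x).continuousAt.continuousWithinAt)
    (fun x hx => by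
      have := (d3 x).hasDerivWithinAt (s := Ici x)
      rw [h x (Ico_subset_Icc_self hx)] at this
      convert this using 1
      ring)
  refine ⟨(deriv φ (-ω₀) + lam * φ (-ω₀)) * Complex.exp (-lam * (-ω₀ : ℝ)), fun ω hω => ?_⟩
  rw [← key ω hω, mul_assoc, ← Complex.exp_add]
  simp

lemma aux_fwd (ω₀ : ℝ) (h0 : 0 < ω₀) (t : ℂ) (lam : ℂ) (hl : lam ≠ 0)
    (φ : ℝ → ℂ) (hφ : ContDiff ℝ 2 φ)
    (h : ∀ ω ∈ Set.Icc (-ω₀) ω₀, iteratedDeriv 2 φ ω = lam ^ 2 * φ ω)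
    (h1 : φ (-ω₀) = (1 + t) * φ 0) (h2 : φ ω₀ = (1 - t) * φ 0)
    (h3 : ∃ ω ∈ Set.Icc (-ω₀) ω₀, φ ω ≠ 0) : Complex.exp (2 * (lam * ω₀)) = 1 := by
  obtain ⟨c, hc⟩ := aux_const ω₀ lam φ hφ h
  obtain ⟨d, hd⟩ := aux_const ω₀ (-lam) φ hφ (by simpa using h)
  have hE : Complex.exp (lam * ω₀) * Complex.exp (-lam * ω₀) = 1 := by
    rw [← Complex.exp_add]; simp
  have e : ∀ ω ∈ Set.Icc (-ω₀) ω₀,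
      2 * lam * φ ω = c * Complex.exp (lam * ω) - d * Complex.exp (-lam * ω) := fun ω hω => by
    linear_combination hc ω hω - hd ω hω
  have e0 := e 0 ⟨by linarith, by linarith⟩
  have e1 := e ω₀ ⟨by linarith, by linarith⟩
  have e2 := e (-ω₀) ⟨by linarith, by linarith⟩
  simp only [Complex.ofReal_zero, mul_zero, Complex.exp_zero, mul_one, Complex.ofReal_neg,
    neg_mul_neg] at e0 e1 e2
  rw [show lam * -(ω₀ : ℂ) = -lam * ω₀ by ring] at e2
  rw [two_mul, Complex.exp_add]
  generalize Complex.exp (lam * ω₀) = E at *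
  generalize Complex.exp (-lam * ω₀) = F at *
  have s : (c - d) * (E + F - 2) = 0 := by
    linear_combination 2 * lam * h1 + 2 * lam * h2 - e1 - e2 + 2 * e0
  rcases mul_eq_zero.1 s with s | s
  · have hcd : c = d := sub_eq_zero.1 s
    subst hcd
    have hc0 : c ≠ 0 := by
      rintro rfl
      obtain ⟨ω, hω, hne⟩ := h3
      have := e ω hω
      simp [hl, hne] at this
    have : c * (E - F) = 0 := by
      linear_combination -e1 + 2 * lam * h2 + (1 - t) * e0
    have : E - F = 0 := (mul_eq_zero.1 this).resolve_left hc0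
    linear_combination E * this + hE
  · have : (E - 1) ^ 2 = 0 := by linear_combination E * s - hE
    have : E - 1 = 0 := by simpa using this
    linear_combination (E + 1) * this

lemma aux_sinh (lam : ℂ) (x : ℝ) :
    iteratedDeriv 2 (fun y : ℝ => Complex.exp (lam * y) - Complex.exp (-lam * y)) x
      = lam ^ 2 * (Complex.exp (lam * x) - Complex.exp (-lam * x)) := by
  rw [iteratedDeriv_succ, iteratedDeriv_one]
  have : deriv (fun y : ℝ => Complex.exp (lam * y) - Complex.exp (-lam * y)) =
      fun y : ℝ => Complex.exp (lam * y) * lam - Complex.exp (-lam * y) * -lam := by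
    funext y
    exact ((aux_exp lam y).sub (aux_exp (-lam) y)).deriv
  rw [this]
  have := (((aux_exp lam x).mul_const lam).sub ((aux_exp (-lam) x).mul_const (-lam))).deriv
  refine Eq.trans this ?_
  ring

/-- The eigenvalues of the nonlocal model problem
`φ'' = λ²φ` on `[−ω₀, ω₀]`, `φ(−ω₀) = (1+t)φ(0)`, `φ(ω₀) = (1−t)φ(0)`
are exactly `λ = (πk/ω₀)i`, `k ∈ ℤ`; in particular they do not depend on `t`. -/
theorem nonlocal_model_problem_eigenvalues
    (ω₀ : ℝ) (hω₀ : ω₀ ∈ Set.Ioo 0 Real.pi) (t : ℂ) (lam : ℂ) :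
    (∃ φ : ℝ → ℂ, ContDiff ℝ 2 φ ∧
      (∀ ω ∈ Set.Icc (-ω₀) ω₀, iteratedDeriv 2 φ ω = lam ^ 2 * φ ω) ∧
      φ (-ω₀) = (1 + t) * φ 0 ∧
      φ ω₀ = (1 - t) * φ 0 ∧
      (∃ ω ∈ Set.Icc (-ω₀) ω₀, φ ω ≠ 0)) ↔
    (∃ k : ℤ, lam = ((Real.pi * (k : ℝ) / ω₀ : ℝ) : ℂ) * Complex.I) := by
  have h0 : 0 < ω₀ := hω₀.1
  have h0c : (ω₀ : ℂ) ≠ 0 := by exact_mod_cast h0.ne'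
  constructor
  · rintro ⟨φ, hφ, h, h1, h2, h3⟩
    by_cases hl : lam = 0
    · exact ⟨0, by simp [hl]⟩
    · obtain ⟨n, hn⟩ := Complex.exp_eq_one_iff.1 (aux_fwd ω₀ h0 t lam hl φ hφ h h1 h2 h3)
      refine ⟨n, ?_⟩
      push_cast
      field_simp
      linear_combination hn / 2
  · rintro ⟨k, hk⟩
    by_cases hk0 : k = 0
    · have hl : lam = 0 := by simp [hk, hk0]
      have d : ∀ x, HasDerivAt (fun y : ℝ => 1 - (t / ω₀) * (y : ℂ)) (-(t / ω₀)) x := fun x => by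
        simpa using ((Complex.ofRealCLM.hasDerivAt (x := x)).const_mul (t / (ω₀ : ℂ))).const_sub 1
      refine ⟨fun y => 1 - (t / ω₀) * (y : ℂ), ?_, ?_, ?_, ?_, 0, ⟨by linarith, by linarith⟩, by simp⟩
      · exact contDiff_const.sub (contDiff_const.mul Complex.ofRealCLM.contDiff)
      · intro ω _
        rw [iteratedDeriv_succ, iteratedDeriv_one, funext fun x => (d x).deriv]
        simp [hl]
      · simp; field_simp
      · simp; field_simp
    · have hkc : (k : ℂ) ≠ 0 := by exact_mod_cast hk0
      have hkr : (k : ℝ) ≠ 0 := by exact_mod_cast hk0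
      have hper : Complex.exp (lam * ω₀) = Complex.exp (-lam * ω₀) := by
        rw [Complex.exp_eq_exp_iff_exists_int]
        refine ⟨k, ?_⟩
        rw [hk]; push_cast; field_simp; ring
      refine ⟨fun y => Complex.exp (lam * y) - Complex.exp (-lam * y), ?_,
        fun ω _ => aux_sinh lam ω, ?_, ?_, ω₀ / (2 * k), ?_, ?_⟩
      · have hc : ∀ a : ℂ, ContDiff ℝ 2 (fun y : ℝ => Complex.exp (a * y)) := fun a =>
          (contDiff_const.mul Complex.ofRealCLM.contDiff).cexp
        exact (hc _).sub (hc _)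
      · simp at hper ⊢
        simp [hper]
      · simp at hper ⊢
        simp [hper]
      · rw [Set.mem_Icc, ← abs_le, abs_div, abs_of_pos h0]
        apply div_le_self h0.le
        have : (1 : ℝ) ≤ |(k : ℝ)| := by exact_mod_cast Int.one_le_abs hk0
        rw [abs_mul, abs_two]; linarith
      · have e1 : lam * ((ω₀ / (2 * k) : ℝ) : ℂ) = Real.pi / 2 * Complex.I := by
          rw [hk]; push_cast; field_simp
        simp only [neg_mul]
        rw [e1, Complex.exp_neg, Complex.exp_pi_div_two_mul_I, Complex.inv_I]
        simp [sub_neg_eq_add, ← two_mul]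
end

section
/- Let ω₀ ∈ (0, π), let t ∈ ℂ with t ≠ 0, and let k be a nonzero integer. Every twice continuously differentiable function φ : ℝ → ℂ satisfying φ''(ω) = ((π k/ω₀)·i)²·φ(ω) for all ω ∈ [−ω₀, ω₀] together with the nonlocal conditions φ(−ω₀) = (1 + t)·φ(0) and φ(ω₀) = (1 − t)·φ(0) is, on [−ω₀, ω₀], a scalar multiple of the function ω ↦ sin(π k ω/ω₀). -/
open Set Complex

/-- For `t ≠ 0` and a nonzero integer `k`, every solution of the nonlocal model
problem at the eigenvalue `λ_k = (πk/ω₀)i` is a scalar multiple of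
`ω ↦ sin(πkω/ω₀)` on `[−ω₀, ω₀]`. -/
theorem nonlocal_model_problem_eigenspace_nonzero
    (ω₀ : ℝ) (hω₀ : ω₀ ∈ Set.Ioo 0 Real.pi) (t : ℂ) (ht : t ≠ 0)
    (k : ℤ) (hk : k ≠ 0) (φ : ℝ → ℂ) (hφ : ContDiff ℝ 2 φ)
    (heq : ∀ ω ∈ Set.Icc (-ω₀) ω₀,
      iteratedDeriv 2 φ ω = (((Real.pi * (k : ℝ) / ω₀ : ℝ) : ℂ) * Complex.I) ^ 2 * φ ω)
    (hbc1 : φ (-ω₀) = (1 + t) * φ 0)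
    (hbc2 : φ ω₀ = (1 - t) * φ 0) :
    ∃ c : ℂ, ∀ ω ∈ Set.Icc (-ω₀) ω₀,
      φ ω = c * ((Real.sin (Real.pi * (k : ℝ) * ω / ω₀) : ℝ) : ℂ) := by
  obtain ⟨h0, -⟩ := hω₀
  obtain ⟨a, ha⟩ : ∃ a : ℝ, a = Real.pi * (k : ℝ) / ω₀ := ⟨_, rfl⟩
  have hk' : (k : ℝ) ≠ 0 := by exact_mod_cast hk
  have ha0 : a ≠ 0 := by
    rw [ha]; exact div_ne_zero (mul_ne_zero Real.pi_ne_zero hk') h0.ne'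
  have haC : (a : ℂ) ≠ 0 := by exact_mod_cast ha0
  rw [← ha] at heq
  have hd1 : ∀ x, HasDerivAt φ (deriv φ x) x := fun x =>
    ((hφ.differentiable (by norm_num)) x).hasDerivAt
  have hφ' : ContDiff ℝ 1 (deriv φ) := by
    have h2 : ContDiff ℝ (1 + 1) φ := by
      rw [one_add_one_eq_two]; exact hφ
    exact (contDiff_succ_iff_deriv.1 h2).2.2
  have hd2 : ∀ x ∈ Set.Icc (-ω₀) ω₀, HasDerivAt (deriv φ) (-(a : ℂ) ^ 2 * φ x) x := by
    intro x hx
    have h1 := ((hφ'.differentiable (by norm_num)) x).hasDerivAt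
    have h2 := heq x hx
    rw [iteratedDeriv_succ, iteratedDeriv_one, mul_pow, Complex.I_sq] at h2
    rw [h2] at h1
    exact h1.congr_deriv (by ring)
  have hc : ∀ x : ℝ, HasDerivAt (fun x : ℝ => ((Real.cos (a * x) : ℝ) : ℂ))
      (-(a : ℂ) * (Real.sin (a * x) : ℝ)) x := by
    intro x
    have h := (((hasDerivAt_id x).const_mul a).cos).ofReal_comp
    simp only [id, mul_one] at h
    exact h.congr_deriv (by push_cast; ring)
  have hs : ∀ x : ℝ, HasDerivAt (fun x : ℝ => ((Real.sin (a * x) : ℝ) : ℂ))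
      ((a : ℂ) * (Real.cos (a * x) : ℝ)) x := by
    intro x
    have h := (((hasDerivAt_id x).const_mul a).sin).ofReal_comp
    simp only [id, mul_one] at h
    exact h.congr_deriv (by push_cast; ring)
  have hconst : ∀ f : ℝ → ℂ, (∀ x ∈ Set.Icc (-ω₀) ω₀, HasDerivAt f 0 x) →
      ∀ x ∈ Set.Icc (-ω₀) ω₀, f x = f 0 := by
    intro f hf x hx
    have h := constant_of_has_deriv_right_zero (f := f) (a := -ω₀) (b := ω₀)
      (fun y hy => (hf y hy).continuousAt.continuousWithinAt)
      (fun y hy => (hf y ⟨hy.1, hy.2.le⟩).hasDerivWithinAt)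
    rw [h x hx, h 0 ⟨by linarith, h0.le⟩]
  have hP := hconst (fun x => (a : ℂ) * φ x * (Real.cos (a * x) : ℝ)
      - deriv φ x * (Real.sin (a * x) : ℝ)) (by
    intro x hx
    exact ((((hd1 x).const_mul (a : ℂ)).mul (hc x)).sub ((hd2 x hx).mul (hs x))).congr_deriv (by ring))
  have hQ := hconst (fun x => (a : ℂ) * φ x * (Real.sin (a * x) : ℝ)
      + deriv φ x * (Real.cos (a * x) : ℝ)) (by
    intro x hx
    exact ((((hd1 x).const_mul (a : ℂ)).mul (hs x)).add ((hd2 x hx).mul (hc x))).congr_deriv (by ring))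
  simp only [mul_zero, Real.sin_zero, Real.cos_zero, Complex.ofReal_zero, Complex.ofReal_one,
    mul_one, sub_zero, zero_add] at hP hQ
  have hsol : ∀ x ∈ Set.Icc (-ω₀) ω₀, (a : ℂ) * φ x =
      a * φ 0 * (Real.cos (a * x) : ℝ) + deriv φ 0 * (Real.sin (a * x) : ℝ) := by
    intro x hx
    have e : ((Real.sin (a * x) : ℝ) : ℂ) ^ 2 + ((Real.cos (a * x) : ℝ) : ℂ) ^ 2 = 1 := by
      exact_mod_cast Real.sin_sq_add_cos_sq (a * x)
    linear_combination (Real.cos (a * x) : ℂ) * hP x hx + (Real.sin (a * x) : ℂ) * hQ x hx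
      - (a : ℂ) * φ x * e
  have haw : a * ω₀ = k * Real.pi := by rw [ha]; field_simp
  have e1 := hsol ω₀ ⟨by linarith, le_rfl⟩
  have e2 := hsol (-ω₀) ⟨le_rfl, by linarith⟩
  rw [mul_neg, Real.cos_neg, Real.sin_neg, haw, Real.sin_int_mul_pi, hbc1] at e2
  rw [haw, Real.sin_int_mul_pi, hbc2] at e1
  have hz : φ 0 = 0 := by
    have : 2 * (a : ℂ) * t * φ 0 = 0 := by
      push_cast at e1 e2
      linear_combination e2 - e1
    simpa [haC, ht] using this
  refine ⟨deriv φ 0 / a, fun x hx => ?_⟩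
  have h := hsol x hx
  have hx' : Real.pi * (k : ℝ) * x / ω₀ = a * x := by rw [ha]; ring
  rw [hx', div_mul_eq_mul_div, eq_div_iff haC]
  rw [hz] at h
  linear_combination h
end

section
/- Let ω₀ ∈ (0, π) and t ∈ ℂ. If λ ∈ ℂ satisfies −1 ≤ Im λ ≤ 0 and there exists a twice continuously differentiable function φ : ℝ → ℂ, not identically zero on [−ω₀, ω₀], with φ''(ω) = λ²·φ(ω) for all ω ∈ [−ω₀, ω₀], φ(−ω₀) = (1 + t)·φ(0) and φ(ω₀) = (1 − t)·φ(0), then λ = 0. That is, the strip −1 ≤ Im λ ≤ 0 contains the unique eigenvalue λ₀ = 0 of the nonlocal model problem. -/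
open Set Complex

/-- The strip `−1 ≤ Im λ ≤ 0` contains the unique eigenvalue `λ₀ = 0` of the
nonlocal model problem. -/
theorem nonlocal_model_problem_unique_eigenvalue_in_strip
    (ω₀ : ℝ) (hω₀ : ω₀ ∈ Set.Ioo 0 Real.pi) (t : ℂ) (lam : ℂ)
    (hstrip : -1 ≤ lam.im ∧ lam.im ≤ 0)
    (heig : ∃ φ : ℝ → ℂ, ContDiff ℝ 2 φ ∧
      (∀ ω ∈ Set.Icc (-ω₀) ω₀, iteratedDeriv 2 φ ω = lam ^ 2 * φ ω) ∧
      φ (-ω₀) = (1 + t) * φ 0 ∧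
      φ ω₀ = (1 - t) * φ 0 ∧
      (∃ ω ∈ Set.Icc (-ω₀) ω₀, φ ω ≠ 0)) :
    lam = 0 := by
  obtain ⟨φ, hφ, hode, hm, hp, w, hw, hne⟩ := heig
  obtain ⟨h0, hpi⟩ := hω₀
  by_contra hlam
  have hd1 : ∀ x, HasDerivAt φ (deriv φ x) x := fun x =>
    ((hφ.differentiable (by norm_num)) x).hasDerivAt
  have hφ' : ContDiff ℝ 1 (deriv φ) := by
    have h2 : ContDiff ℝ (1 + 1) φ := by
      rw [one_add_one_eq_two]; exact hφ
    exact (contDiff_succ_iff_deriv.1 h2).2.2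
  have hd2 : ∀ x ∈ Set.Icc (-ω₀) ω₀, HasDerivAt (deriv φ) (lam ^ 2 * φ x) x := by
    intro x hx
    have h := ((hφ'.differentiable (by norm_num)) x).hasDerivAt
    rw [← hode x hx, iteratedDeriv_succ, iteratedDeriv_one]
    exact h
  have hl : ∀ x : ℝ, HasDerivAt (fun y : ℝ => lam * (y : ℂ)) lam x := fun x => by
    simpa using (Complex.ofRealCLM.hasDerivAt (x := x)).const_mul lam
  have hcosh : ∀ x : ℝ, HasDerivAt (fun y : ℝ => cosh (lam * (y : ℂ)))
      (sinh (lam * x) * lam) x := fun x => by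
    exact (Complex.hasDerivAt_cosh (lam * x)).comp x (hl x)
  have hsinh : ∀ x : ℝ, HasDerivAt (fun y : ℝ => sinh (lam * (y : ℂ)))
      (cosh (lam * x) * lam) x := fun x => by
    exact (Complex.hasDerivAt_sinh (lam * x)).comp x (hl x)
  have const : ∀ f : ℝ → ℂ, (∀ x ∈ Set.Icc (-ω₀) ω₀, HasDerivAt f 0 x) →
      ∀ x ∈ Set.Icc (-ω₀) ω₀, f x = f 0 := by
    intro f hf x hx
    have key := constant_of_has_deriv_right_zero
      (fun y hy => (hf y hy).continuousAt.continuousWithinAt)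
      (fun y hy => (hf y (Ico_subset_Icc_self hy)).hasDerivWithinAt)
    rw [key x hx, key 0 ⟨by linarith, by linarith⟩]
  have c1 := const (fun x => lam * (φ x * cosh (lam * x)) - deriv φ x * sinh (lam * x)) (by
    intro x hx
    refine ((((hd1 x).mul (hcosh x)).const_mul lam).sub ((hd2 x hx).mul (hsinh x))).congr_deriv ?_
    ring)
  have c2 := const (fun x => deriv φ x * cosh (lam * x) - lam * (φ x * sinh (lam * x))) (by
    intro x hx
    refine (((hd2 x hx).mul (hcosh x)).sub (((hd1 x).mul (hsinh x)).const_mul lam)).congr_deriv ?_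
    ring)
  have sol : ∀ x ∈ Set.Icc (-ω₀) ω₀,
      lam * φ x = lam * φ 0 * cosh (lam * x) + deriv φ 0 * sinh (lam * x) := by
    intro x hx
    have e1 := c1 x hx
    have e2 := c2 x hx
    simp only [ofReal_zero, mul_zero, cosh_zero, sinh_zero, mul_one, sub_zero] at e1 e2
    have e3 := Complex.cosh_sq_sub_sinh_sq (lam * x)
    linear_combination cosh (lam * x) * e1 + sinh (lam * x) * e2 - lam * φ x * e3
  have sp := sol ω₀ ⟨by linarith, le_rfl⟩
  have sm := sol (-ω₀) ⟨le_rfl, by linarith⟩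
  rw [hp] at sp
  rw [hm] at sm
  simp only [ofReal_neg, mul_neg, cosh_neg, sinh_neg] at sm
  have hs : sinh (lam * ω₀) = 0 := by
    by_cases hA : φ 0 = 0
    · rw [hA] at sp
      simp only [mul_zero, zero_mul, zero_add] at sp
      rcases mul_eq_zero.1 sp.symm with h | h
      · exfalso
        have := sol w hw
        rw [hA, h] at this
        simp [hlam, hne] at this
      · exact h
    · have hc : cosh (lam * ω₀) = 1 := by
        have : lam * φ 0 * (cosh (lam * ω₀) - 1) = 0 := by
          linear_combination -(1/2 : ℂ) * (sp + sm)
        rcases mul_eq_zero.1 this with h | h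
        · exact absurd h (mul_ne_zero hlam hA)
        · exact sub_eq_zero.1 h
      have e3 := Complex.cosh_sq_sub_sinh_sq (lam * ω₀)
      rw [hc] at e3
      have : sinh (lam * ω₀) ^ 2 = 0 := by linear_combination -e3
      exact pow_eq_zero_iff (two_ne_zero) |>.1 this
  have hexp : exp (2 * (lam * ω₀)) = 1 := by
    have h1 : exp (lam * ω₀) = cosh (lam * ω₀) := by
      rw [← Complex.cosh_add_sinh, hs, add_zero]
    have e3 := Complex.cosh_sq_sub_sinh_sq (lam * ω₀)
    rw [two_mul, Complex.exp_add, h1]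
    rw [hs] at e3
    linear_combination e3
  obtain ⟨n, hn⟩ := Complex.exp_eq_one_iff.1 hexp
  have hre := congrArg Complex.re hn
  have him := congrArg Complex.im hn
  simp at hre him
  have him' : lam.im * ω₀ = n * Real.pi := by linarith
  have hpos := Real.pi_pos
  have hn1 : (n : ℝ) < 1 := by nlinarith
  have hn2 : (-1 : ℝ) < n := by nlinarith
  have hn0 : n = 0 := by
    have a : n < 1 := by exact_mod_cast hn1
    have b : -1 < n := by exact_mod_cast hn2
    omega
  rw [hn0] at hn
  have : (ω₀ : ℂ) ≠ 0 := by exact_mod_cast h0.ne'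
  simp [hlam, this] at hn
end

section
/- Let 0 < ω₀ < π/2. If λ ∈ ℂ satisfies −1 ≤ Im λ ≤ 0, then every twice continuously differentiable function φ : ℝ → ℂ with φ''(ω) = λ²·φ(ω) for all ω ∈ [−ω₀, ω₀] and φ(−ω₀) = φ(ω₀) = 0 vanishes identically on [−ω₀, ω₀]. That is, the strip −1 ≤ Im λ ≤ 0 contains no eigenvalues of the Dirichlet model problem. -/
open Set Complex

lemma aux_const_s5 (a b : ℝ) (f : ℝ → ℂ) (h : ∀ x ∈ Set.Icc a b, HasDerivAt f 0 x) :
    ∀ x ∈ Set.Icc a b, f x = f a :=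
  constant_of_has_deriv_right_zero
    (fun x hx => (h x hx).continuousAt.continuousWithinAt)
    (fun x hx => (h x ⟨hx.1, hx.2.le⟩).hasDerivWithinAt)

/-- For `0 < ω₀ < π/2`, the strip `−1 ≤ Im λ ≤ 0` contains no eigenvalues of
the Dirichlet model problem: every solution of `φ'' = λ²φ` on `[−ω₀, ω₀]` with
`φ(±ω₀) = 0` vanishes identically on `[−ω₀, ω₀]`. -/
theorem dirichlet_model_problem_no_eigenvalues_in_strip
    (ω₀ : ℝ) (hω₀ : 0 < ω₀) (hω₀' : ω₀ < Real.pi / 2) (lam : ℂ)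
    (hstrip : -1 ≤ lam.im ∧ lam.im ≤ 0)
    (φ : ℝ → ℂ) (hφ : ContDiff ℝ 2 φ)
    (heq : ∀ ω ∈ Set.Icc (-ω₀) ω₀, iteratedDeriv 2 φ ω = lam ^ 2 * φ ω)
    (hbc1 : φ (-ω₀) = 0) (hbc2 : φ ω₀ = 0) :
    ∀ ω ∈ Set.Icc (-ω₀) ω₀, φ ω = 0 := by
  have h1 : ∀ x, HasDerivAt φ (deriv φ x) x := fun x =>
    (hφ.differentiable (by norm_num) x).hasDerivAt
  have hφ' : ContDiff ℝ 1 (deriv φ) := by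
    have : ContDiff ℝ (1 + 1) φ := by
      convert hφ using 1
      norm_num
    exact (contDiff_succ_iff_deriv.1 this).2.2
  have h2 : ∀ x ∈ Set.Icc (-ω₀) ω₀, HasDerivAt (deriv φ) (lam ^ 2 * φ x) x := by
    intro x hx
    rw [← heq x hx, iteratedDeriv_succ, iteratedDeriv_one]
    exact (hφ'.differentiable (by norm_num) x).hasDerivAt
  have hr : ω₀ ∈ Set.Icc (-ω₀) ω₀ := ⟨by linarith, le_rfl⟩
  have ht : ∀ x : ℝ, HasDerivAt (fun t : ℝ => ((t : ℂ) + ω₀)) 1 x := fun x =>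
    (Complex.ofRealCLM.hasDerivAt (x := x)).add_const _
  by_cases hl : lam = 0
  · subst hl
    have hA := aux_const_s5 (-ω₀) ω₀ (deriv φ) (fun x hx => by simpa using h2 x hx)
    have hB := aux_const_s5 (-ω₀) ω₀ (fun t => deriv φ t * ((t : ℂ) + ω₀) - φ t) (fun x hx => by
      have := ((h2 x hx).mul (ht x)).sub (h1 x)
      exact this.congr_deriv (by simp))
    simp only [hbc1, ofReal_neg, neg_add_cancel, mul_zero, sub_zero] at hB
    have h0 : deriv φ (-ω₀) = 0 := by
      have := hB ω₀ hr
      rw [hA _ hr, hbc2, sub_zero] at this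
      rcases mul_eq_zero.1 this with h | h
      · exact h
      · exfalso
        have : ω₀ + ω₀ = 0 := by exact_mod_cast h
        linarith
    intro x hx
    have := hB x hx
    rw [hA x hx, h0] at this
    simpa using this
  · have hs : ∀ x : ℝ, HasDerivAt (fun t : ℝ => Complex.sinh (lam * ((t : ℂ) + ω₀)))
        (Complex.cosh (lam * ((x : ℂ) + ω₀)) * lam) x := fun x => by
      exact ((Complex.hasDerivAt_sinh _).comp x ((ht x).const_mul lam)).congr_deriv (by simp)
    have hc : ∀ x : ℝ, HasDerivAt (fun t : ℝ => Complex.cosh (lam * ((t : ℂ) + ω₀)))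
        (Complex.sinh (lam * ((x : ℂ) + ω₀)) * lam) x := fun x => by
      exact ((Complex.hasDerivAt_cosh _).comp x ((ht x).const_mul lam)).congr_deriv (by simp)
    have hA := aux_const_s5 (-ω₀) ω₀ (fun t => deriv φ t * Complex.cosh (lam * ((t : ℂ) + ω₀))
        - lam * φ t * Complex.sinh (lam * ((t : ℂ) + ω₀))) (fun x hx => by
      have := ((h2 x hx).mul (hc x)).sub (((h1 x).const_mul lam).mul (hs x))
      exact this.congr_deriv (by ring))
    have hB := aux_const_s5 (-ω₀) ω₀ (fun t => lam * φ t * Complex.cosh (lam * ((t : ℂ) + ω₀))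
        - deriv φ t * Complex.sinh (lam * ((t : ℂ) + ω₀))) (fun x hx => by
      have := (((h1 x).const_mul lam).mul (hc x)).sub ((h2 x hx).mul (hs x))
      exact this.congr_deriv (by ring))
    simp only [hbc1, ofReal_neg, neg_add_cancel, mul_zero, sub_zero,
      Complex.sinh_zero, Complex.cosh_zero, mul_one] at hA hB
    have key : ∀ x ∈ Set.Icc (-ω₀) ω₀,
        lam * φ x = deriv φ (-ω₀) * Complex.sinh (lam * ((x : ℂ) + ω₀)) := by
      intro x hx
      have a := hA x hx
      have b := hB x hx
      have c := Complex.cosh_sq_sub_sinh_sq (lam * ((x : ℂ) + ω₀))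
      linear_combination Complex.sinh (lam * ((x : ℂ) + ω₀)) * a
        + Complex.cosh (lam * ((x : ℂ) + ω₀)) * b - lam * φ x * c
    have hne : Complex.sinh (lam * ((ω₀ : ℂ) + ω₀)) ≠ 0 := by
      intro h
      have h' : Complex.sin (lam * ((ω₀ : ℂ) + ω₀) * I) = 0 := by
        rw [Complex.sin_mul_I, h, zero_mul]
      obtain ⟨k, hk⟩ := Complex.sin_eq_zero_iff.1 h'
      have hre := congrArg Complex.re hk
      have him := congrArg Complex.im hk
      simp at hre him
      have hpi := Real.pi_pos
      have hk0 : k = 0 := by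
        have l1 : (k : ℝ) < 1 := by
          by_contra hcon
          push Not at hcon
          nlinarith
        have l2 : (-1 : ℝ) < k := by
          by_contra hcon
          push Not at hcon
          nlinarith
        have l1' : k < 1 := by exact_mod_cast l1
        have l2' : -1 < k := by exact_mod_cast l2
        omega
      subst hk0
      apply hl
      apply Complex.ext
      · rcases him with h | h
        · simpa using h
        · linarith
      · have : lam.im * (ω₀ + ω₀) = 0 := by simpa using hre
        rcases mul_eq_zero.1 this with h | h
        · simpa using h
        · linarith
    have h0 : deriv φ (-ω₀) = 0 := by
      have := key ω₀ hr
      rw [hbc2, mul_zero] at this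
      exact (mul_eq_zero.1 this.symm).resolve_right hne
    intro x hx
    have := key x hx
    rw [h0, zero_mul] at this
    exact (mul_eq_zero.1 this).resolve_left hl
end

section
/- Let G ⊂ ℝ² be a bounded, open, connected set, let g₁, g₂ ∈ ∂G, and let Γ₁, Γ₂ ⊆ ∂G be sets with ∂G = Γ₁ ∪ Γ₂ ∪ {g₁, g₂}. Let Ω₁, Ω₂ : ℝ² → ℝ² be maps with Ω₁(Γ₁) ⊆ G and Ω₂(Γ₂) ⊆ G. Suppose u : ℝ² → ℝ is continuous on the closure of G, harmonic on G (i.e., u is twice continuously differentiable on G and Δu = ∂²u/∂y₁² + ∂²u/∂y₂² = 0 on G), satisfies u(g₁) = u(g₂) = 0, and satisfies the nonlocal conditions u(y) = u(Ω₁(y)) for all y ∈ Γ₁ and u(y) = u(Ω₂(y)) for all y ∈ Γ₂. Then u = 0 on the closure of G. -/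
open Set

/-- The Laplacian of `u : ℝ² → ℝ` at a point, written via iterated directional
(Fréchet) derivatives: `Δu = ∂²u/∂y₁² + ∂²u/∂y₂²`. -/
noncomputable def laplacian2 (u : ℝ × ℝ → ℝ) (y : ℝ × ℝ) : ℝ :=
  fderiv ℝ (fun z => fderiv ℝ u z (1, 0)) y (1, 0) +
    fderiv ℝ (fun z => fderiv ℝ u z (0, 1)) y (0, 1)

open InnerProductSpace Topology Laplacian in
lemma harm_aux {G : Set (ℝ × ℝ)} (hG : IsOpen G) {u : ℝ × ℝ → ℝ} (hu : ContDiffOn ℝ 2 u G)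
    (hl : ∀ y ∈ G, laplacian2 u y = 0) :
    HarmonicOnNhd (fun z : ℂ => u (Complex.equivRealProdCLM z)) (Complex.equivRealProdCLM ⁻¹' G) := by
  have hG' : IsOpen (Complex.equivRealProdCLM ⁻¹' G) :=
    hG.preimage Complex.equivRealProdCLM.continuous
  have hc : ∀ z ∈ Complex.equivRealProdCLM ⁻¹' G,
      ContDiffAt ℝ 2 (fun z : ℂ => u (Complex.equivRealProdCLM z)) z := by
    intro z hz
    have := hu.contDiffAt (hG.mem_nhds hz)
    exact this.comp z Complex.equivRealProdCLM.contDiff.contDiffAt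
  intro z hz
  refine ⟨hc z hz, ?_⟩
  filter_upwards [hG'.mem_nhds hz] with x hx
  rw [laplacian_eq_iteratedFDeriv_complexPlane]
  simp only [iteratedFDeriv_two_apply, Pi.zero_apply]
  have key : ∀ m : ℂ, fderiv ℝ (fderiv ℝ (fun z : ℂ => u (Complex.equivRealProdCLM z))) x m m
      = fderiv ℝ (fun z => fderiv ℝ u z (Complex.equivRealProdCLM m))
        (Complex.equivRealProdCLM x) (Complex.equivRealProdCLM m) := by
    intro m
    have hd1 : DifferentiableAt ℝ (fderiv ℝ (fun z : ℂ => u (Complex.equivRealProdCLM z))) x :=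
      ((hc x hx).fderiv_right (m := 1) (by norm_num)).differentiableAt (by norm_num)
    have hd2 : DifferentiableAt ℝ (fderiv ℝ u) (Complex.equivRealProdCLM x) :=
      ((hu.contDiffAt (hG.mem_nhds hx)).fderiv_right (m := 1)
        (by norm_num)).differentiableAt (by norm_num)
    have h1 : fderiv ℝ (fun z => fderiv ℝ (fun z : ℂ => u (Complex.equivRealProdCLM z)) z m) x m
      = fderiv ℝ (fderiv ℝ (fun z : ℂ => u (Complex.equivRealProdCLM z))) x m m := by
      rw [fderiv_clm_apply hd1 (differentiableAt_const m)]
      simp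
    rw [← h1]
    have h2 : (fun z => fderiv ℝ (fun z : ℂ => u (Complex.equivRealProdCLM z)) z m)
      = (fun y => fderiv ℝ u y (Complex.equivRealProdCLM m)) ∘ Complex.equivRealProdCLM := by
      funext z
      have := Complex.equivRealProdCLM.comp_right_fderiv (f := u) (x := z)
      change fderiv ℝ (u ∘ Complex.equivRealProdCLM) z m = _
      rw [this]
      rfl
    rw [h2, Complex.equivRealProdCLM.comp_right_fderiv]
    rfl
  have := hl _ hx
  unfold laplacian2 at this
  have e1 : Complex.equivRealProdCLM 1 = (1, 0) := by simp
  have eI : Complex.equivRealProdCLM Complex.I = (0, 1) := by simp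
  have k1 := key 1
  have kI := key Complex.I
  rw [e1] at k1
  rw [eI] at kI
  rw [← k1, ← kI] at this
  simpa using this

open InnerProductSpace Topology in
lemma max_aux {U : Set ℂ} (hU : IsOpen U) (hc : IsPreconnected U) {v : ℂ → ℝ}
    (hv : HarmonicOnNhd v U) {z : ℂ} (hz : z ∈ U) (hm : ∀ w ∈ U, v w ≤ v z) :
    ∀ w ∈ U, v w = v z := by
  have ha : AnalyticOnNhd ℝ v U := fun w hw => HarmonicAt.analyticAt (hv w hw)
  have hlocal : v =ᶠ[𝓝 z] fun _ => v z := by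
    obtain ⟨R, hR, hb⟩ := Metric.isOpen_iff.1 hU z hz
    obtain ⟨F, hF, hre⟩ := HarmonicOnNhd.exists_analyticOnNhd_ball_re_eq (hv.mono hb)
    have hbn := Metric.ball_mem_nhds z hR
    have hn : ∀ w ∈ Metric.ball z R, ‖Complex.exp (F w)‖ = Real.exp (v w) := by
      intro w hw
      rw [Complex.norm_exp]
      exact congrArg Real.exp (hre hw)
    have := Complex.norm_eventually_eq_of_isLocalMax (f := fun w => Complex.exp (F w)) (c := z)
      (by
        filter_upwards [hbn] with w hw
        exact (hF w hw).differentiableAt.cexp)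
      (by
        filter_upwards [hbn] with w hw
        simp only [Function.comp]
        rw [hn w hw, hn z (Metric.mem_ball_self hR)]
        exact Real.exp_le_exp.2 (hm w (hb hw)))
    filter_upwards [this, hbn] with w h1 hw
    rw [hn w hw, hn z (Metric.mem_ball_self hR)] at h1
    exact Real.exp_injective h1
  exact fun w hw => ha.eqOn_of_preconnected_of_eventuallyEq analyticOnNhd_const hc hz hlocal hw

open InnerProductSpace in
lemma le_aux
    (G : Set (ℝ × ℝ)) (hGopen : IsOpen G) (hGconn : IsConnected G)
    (hGbdd : Bornology.IsBounded G)
    (g₁ g₂ : ℝ × ℝ) (hg₁ : g₁ ∈ frontier G)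
    (Γ₁ Γ₂ : Set (ℝ × ℝ))
    (hbd : frontier G = Γ₁ ∪ Γ₂ ∪ {g₁, g₂})
    (Ω₁ Ω₂ : ℝ × ℝ → ℝ × ℝ) (hΩ₁ : Ω₁ '' Γ₁ ⊆ G) (hΩ₂ : Ω₂ '' Γ₂ ⊆ G)
    (u : ℝ × ℝ → ℝ)
    (hucont : ContinuousOn u (closure G))
    (hh : HarmonicOnNhd (fun z : ℂ => u (Complex.equivRealProdCLM z))
      (Complex.equivRealProdCLM ⁻¹' G))
    (hug₁ : u g₁ = 0) (hug₂ : u g₂ = 0)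
    (hnl₁ : ∀ y ∈ Γ₁, u y = u (Ω₁ y))
    (hnl₂ : ∀ y ∈ Γ₂, u y = u (Ω₂ y)) :
    ∀ y ∈ closure G, u y ≤ 0 := by
  obtain ⟨p, hp, hmax⟩ := hGbdd.isCompact_closure.exists_isMaxOn hGconn.nonempty.closure hucont
  have hmax' : ∀ y ∈ closure G, u y ≤ u p := fun y hy => hmax hy
  have hin : ∀ q ∈ G, u q = u p → u p = 0 := by
    intro q hq hqp
    have hconn : IsPreconnected (Complex.equivRealProdCLM ⁻¹' G) := by
      have := (Complex.equivRealProdCLM.toHomeomorph.isPreconnected_preimage (s := G)).2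
        hGconn.isPreconnected
      exact this
    have hconst := max_aux (hGopen.preimage Complex.equivRealProdCLM.continuous) hconn hh
      (z := Complex.equivRealProdCLM.symm q) (by simpa using hq) (by
        intro w hw
        have := hmax' _ (subset_closure hw)
        simpa [hqp] using this)
    have hG : EqOn u (fun _ => u p) G := by
      intro y hy
      have := hconst (Complex.equivRealProdCLM.symm y) (by simpa using hy)
      simpa [hqp] using this
    have := hG.of_subset_closure hucont continuousOn_const subset_closure Subset.rfl
      (frontier_subset_closure hg₁)
    simp only [hug₁] at this
    exact this.symm
  have hp0 : u p = 0 := by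
    by_cases hpG : p ∈ G
    · exact hin p hpG rfl
    · have hpf : p ∈ frontier G := by
        rw [hGopen.frontier_eq]; exact ⟨hp, hpG⟩
      rw [hbd] at hpf
      rcases hpf with (h | h) | h | h
      · exact hin _ (hΩ₁ ⟨p, h, rfl⟩) (hnl₁ p h).symm
      · exact hin _ (hΩ₂ ⟨p, h, rfl⟩) (hnl₂ p h).symm
      · rw [h, hug₁]
      · rw [mem_singleton_iff.1 h, hug₂]
  intro y hy
  rw [← hp0]
  exact hmax' y hy

/-- A continuous function on the closure of a bounded domain `G ⊂ ℝ²`, harmonic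
in `G`, vanishing at the conjugation points `g₁, g₂` and satisfying the nonlocal
conditions `u|_{Γ₁} = u(Ω₁(y))|_{Γ₁}`, `u|_{Γ₂} = u(Ω₂(y))|_{Γ₂}` with
`Ω₁(Γ₁) ⊆ G`, `Ω₂(Γ₂) ⊆ G`, vanishes identically on the closure of `G`. -/
theorem kernel_nonlocal_operator_trivial
    (G : Set (ℝ × ℝ)) (hGopen : IsOpen G) (hGconn : IsConnected G)
    (hGbdd : Bornology.IsBounded G)
    (g₁ g₂ : ℝ × ℝ) (hg₁ : g₁ ∈ frontier G) (hg₂ : g₂ ∈ frontier G)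
    (Γ₁ Γ₂ : Set (ℝ × ℝ)) (hΓ₁ : Γ₁ ⊆ frontier G) (hΓ₂ : Γ₂ ⊆ frontier G)
    (hbd : frontier G = Γ₁ ∪ Γ₂ ∪ {g₁, g₂})
    (Ω₁ Ω₂ : ℝ × ℝ → ℝ × ℝ) (hΩ₁ : Ω₁ '' Γ₁ ⊆ G) (hΩ₂ : Ω₂ '' Γ₂ ⊆ G)
    (u : ℝ × ℝ → ℝ)
    (hucont : ContinuousOn u (closure G))
    (huC2 : ContDiffOn ℝ 2 u G)
    (huharm : ∀ y ∈ G, laplacian2 u y = 0)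
    (hug₁ : u g₁ = 0) (hug₂ : u g₂ = 0)
    (hnl₁ : ∀ y ∈ Γ₁, u y = u (Ω₁ y))
    (hnl₂ : ∀ y ∈ Γ₂, u y = u (Ω₂ y)) :
    ∀ y ∈ closure G, u y = 0 := by
  have hh := harm_aux hGopen huC2 huharm
  have h1 := le_aux G hGopen hGconn hGbdd g₁ g₂ hg₁ Γ₁ Γ₂ hbd Ω₁ Ω₂ hΩ₁ hΩ₂ u hucont hh
    hug₁ hug₂ hnl₁ hnl₂
  have h2 := le_aux G hGopen hGconn hGbdd g₁ g₂ hg₁ Γ₁ Γ₂ hbd Ω₁ Ω₂ hΩ₁ hΩ₂ (fun y => - u y)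
    hucont.neg hh.neg (by simp [hug₁]) (by simp [hug₂])
    (fun y hy => by simp only [hnl₁ y hy]) (fun y hy => by simp only [hnl₂ y hy])
  intro y hy
  have a := h1 y hy
  have b := h2 y hy
  linarith
end

section
/- Let G ⊂ ℝ² be a bounded, open, connected set, let g₁, g₂ ∈ ∂G, and let Γ₁, Γ₂ ⊆ ∂G be sets with ∂G = Γ₁ ∪ Γ₂ ∪ {g₁, g₂}. Let t ∈ ℝ with |t| ≤ 1, and let Ω : ℝ² → ℝ² be a map with Ω(Γ₁) ⊆ G. Suppose u : ℝ² → ℝ is continuous on the closure of G, harmonic on G (i.e., u is twice continuously differentiable on G and Δu = ∂²u/∂y₁² + ∂²u/∂y₂² = 0 on G), satisfies u(y) = 0 for all y ∈ Γ₂ ∪ {g₁, g₂}, and satisfies the nonlocal condition u(y) = −t·u(Ω(y)) for all y ∈ Γ₁. Then u = 0 on the closure of G. -/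
open Set

open Filter Topology in
lemma aux_harm {G : Set (ℝ × ℝ)} (hG : IsOpen G) {u : ℝ × ℝ → ℝ}
    (hu : ContDiffOn ℝ 2 u G) (hl : ∀ y ∈ G, laplacian2 u y = 0) :
    InnerProductSpace.HarmonicOnNhd (u ∘ Complex.equivRealProdCLM)
      (Complex.equivRealProdCLM ⁻¹' G) := by
  have key : ∀ z, Complex.equivRealProdCLM z ∈ G →
      Laplacian.laplacian (u ∘ Complex.equivRealProdCLM) z = 0 := by
    intro z hz
    have hc : ContDiffAt ℝ 2 u (Complex.equivRealProdCLM z) := hu.contDiffAt (hG.mem_nhds hz)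
    have hd : DifferentiableAt ℝ (fderiv ℝ u) (Complex.equivRealProdCLM z) :=
      (hc.fderiv_right (m := 1) (by norm_num)).differentiableAt (by norm_num)
    have h0 := hl _ hz
    have hf : fderiv ℝ (u ∘ Complex.equivRealProdCLM) = fun w =>
        (fderiv ℝ u (Complex.equivRealProdCLM w)).comp
          (Complex.equivRealProdCLM : ℂ →L[ℝ] ℝ × ℝ) := by
      funext w
      exact Complex.equivRealProdCLM.comp_right_fderiv
    have hs : ∀ a : ℂ, fderiv ℝ (fderiv ℝ (u ∘ Complex.equivRealProdCLM)) z a a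
        = fderiv ℝ (fun y => fderiv ℝ u y (Complex.equivRealProdCLM a))
          (Complex.equivRealProdCLM z) (Complex.equivRealProdCLM a) := by
      intro a
      have h1 : HasFDerivAt (fun w => fderiv ℝ u (Complex.equivRealProdCLM w))
          ((fderiv ℝ (fderiv ℝ u) (Complex.equivRealProdCLM z)).comp
            (Complex.equivRealProdCLM : ℂ →L[ℝ] ℝ × ℝ)) z :=
        hd.hasFDerivAt.comp z Complex.equivRealProdCLM.hasFDerivAt
      rw [hf, (h1.clm_comp (hasFDerivAt_const _ _)).fderiv,
        (hd.hasFDerivAt.clm_apply (hasFDerivAt_const _ _)).fderiv]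
      simp
    rw [InnerProductSpace.laplacian_eq_iteratedFDeriv_complexPlane]
    simp only [iteratedFDeriv_two_apply]
    have e1 := hs 1
    have e2 := hs Complex.I
    simp only [Complex.equivRealProdCLM_apply, Complex.one_re, Complex.one_im, Complex.I_re,
      Complex.I_im] at e1 e2
    simp only [laplacian2, Complex.equivRealProdCLM_apply] at h0
    simp only [Matrix.cons_val_zero, Matrix.cons_val_one]
    rw [e1, e2]
    exact h0
  intro z hz
  refine ⟨(hu.contDiffAt (hG.mem_nhds hz)).comp z Complex.equivRealProdCLM.contDiff.contDiffAt, ?_⟩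
  have ho : IsOpen (Complex.equivRealProdCLM ⁻¹' G) :=
    hG.preimage Complex.equivRealProdCLM.continuous
  filter_upwards [ho.mem_nhds hz] with w hw
  exact key w hw

open Filter Topology in
lemma aux_loc {v : ℂ → ℝ} {z : ℂ} (hv : InnerProductSpace.HarmonicAt v z) (hm : IsLocalMax v z) :
    ∀ᶠ w in 𝓝 z, v w = v z := by
  obtain ⟨r, hr, hb⟩ := Metric.eventually_nhds_iff_ball.1 hv.eventually
  obtain ⟨F, hF, hre⟩ := InnerProductSpace.HarmonicOnNhd.exists_analyticOnNhd_ball_re_eq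
    (f := v) (z := z) (R := r) hb
  have hball := Metric.ball_mem_nhds z hr
  have hz := hre (Metric.mem_ball_self hr)
  simp only at hz
  have h := Complex.norm_eventually_eq_of_isLocalMax (f := fun w => Complex.exp (F w)) (c := z)
    (by filter_upwards [hball] with w hw using (hF w hw).differentiableAt.cexp)
    (by
      filter_upwards [hball, hm] with w hw hle
      have := hre hw
      simp only at this
      simp only [Function.comp, Complex.norm_exp, this, hz]
      exact Real.exp_le_exp.2 hle)
  filter_upwards [hball, h] with w hw he
  have := hre hw
  simp only at this
  simpa only [Complex.norm_exp, this, hz, Real.exp_eq_exp] using he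

open Filter Topology in
lemma aux_max {U : Set ℂ} (hU : IsOpen U) (hc : IsPreconnected U) {v : ℂ → ℝ}
    (hv : InnerProductSpace.HarmonicOnNhd v U) {z : ℂ} (hz : z ∈ U) (hm : ∀ w ∈ U, v w ≤ v z) :
    ∀ w ∈ U, v w = v z := by
  have hloc : ∀ w ∈ U, v w = v z → ∀ᶠ y in 𝓝 w, v y = v z := by
    intro w hw he
    rw [← he]
    refine aux_loc (hv w hw) ?_
    filter_upwards [hU.mem_nhds hw] with y hy
    rw [he]; exact hm y hy
  have hsub : U ⊆ {w | w ∈ U ∧ v w = v z} := by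
    refine hc.subset_of_closure_inter_subset ?_ ⟨z, hz, hz, rfl⟩ ?_
    · rw [isOpen_iff_mem_nhds]
      rintro w ⟨hw, he⟩
      filter_upwards [hU.mem_nhds hw, hloc w hw he] with y h1 h2 using ⟨h1, h2⟩
    · rintro w ⟨hw, hwU⟩
      refine ⟨hwU, ?_⟩
      have hcw : ContinuousAt v w := (hv w hwU).1.continuousAt
      by_contra hne
      have hev := hcw.eventually_ne hne
      obtain ⟨y, hy1, hy2⟩ := (mem_closure_iff_frequently.1 hw).and_eventually hev |>.exists
      exact hy2 hy1.2
  exact fun w hw => (hsub hw).2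

/-- Lemma 4.1: a continuous function on the closure of a bounded domain
`G ⊂ ℝ²`, harmonic in `G`, vanishing on `Γ₂ ∪ {g₁, g₂}` and satisfying the
nonlocal condition `u|_{Γ₁} + t·u(Ω(y))|_{Γ₁} = 0` with `|t| ≤ 1` real and
`Ω(Γ₁) ⊆ G`, vanishes identically on the closure of `G`. -/
theorem kernel_Pt_trivial
    (G : Set (ℝ × ℝ)) (hGopen : IsOpen G) (hGconn : IsConnected G)
    (hGbdd : Bornology.IsBounded G)
    (g₁ g₂ : ℝ × ℝ) (hg₁ : g₁ ∈ frontier G) (hg₂ : g₂ ∈ frontier G)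
    (Γ₁ Γ₂ : Set (ℝ × ℝ)) (hΓ₁ : Γ₁ ⊆ frontier G) (hΓ₂ : Γ₂ ⊆ frontier G)
    (hbd : frontier G = Γ₁ ∪ Γ₂ ∪ {g₁, g₂})
    (t : ℝ) (ht : |t| ≤ 1)
    (Ω : ℝ × ℝ → ℝ × ℝ) (hΩ : Ω '' Γ₁ ⊆ G)
    (u : ℝ × ℝ → ℝ)
    (hucont : ContinuousOn u (closure G))
    (huC2 : ContDiffOn ℝ 2 u G)
    (huharm : ∀ y ∈ G, laplacian2 u y = 0)
    (huΓ₂ : ∀ y ∈ Γ₂ ∪ {g₁, g₂}, u y = 0)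
    (hnl : ∀ y ∈ Γ₁, u y = -t * u (Ω y)) :
    ∀ y ∈ closure G, u y = 0 := by
  have hcomp : IsCompact (closure G) := hGbdd.isCompact_closure
  obtain ⟨y₀, hy₀, hmax⟩ := hcomp.exists_isMaxOn hGconn.nonempty.closure hucont.abs
  have hmax : ∀ y ∈ closure G, |u y| ≤ |u y₀| := fun y hy => hmax hy
  -- it suffices to show that the maximum vanishes
  suffices h0 : u y₀ = 0 by
    intro y hy
    have := hmax y hy
    rw [h0, abs_zero] at this
    exact abs_nonpos_iff.1 this
  by_contra hne
  -- the maximum is attained inside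
  have hin : ∃ x ∈ G, |u x| = |u y₀| := by
    by_cases hyG : y₀ ∈ G
    · exact ⟨y₀, hyG, rfl⟩
    have hfr : y₀ ∈ frontier G := by
      rw [hGopen.frontier_eq]; exact ⟨hy₀, hyG⟩
    rw [hbd, union_assoc] at hfr
    rcases hfr with h1 | h2
    · have hx : Ω y₀ ∈ G := hΩ ⟨y₀, h1, rfl⟩
      refine ⟨Ω y₀, hx, le_antisymm (hmax _ (subset_closure hx)) ?_⟩
      rw [hnl y₀ h1, abs_mul, abs_neg]
      exact mul_le_of_le_one_left (abs_nonneg _) ht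
    · exact absurd (huΓ₂ y₀ h2) hne
  obtain ⟨x, hx, hxe⟩ := hin
  have hharm := aux_harm hGopen huC2 huharm
  have hUo : IsOpen (Complex.equivRealProdCLM ⁻¹' G) :=
    hGopen.preimage Complex.equivRealProdCLM.continuous
  have hUc : IsPreconnected (Complex.equivRealProdCLM ⁻¹' G) :=
    (Complex.equivRealProdCLM.toHomeomorph.isPreconnected_preimage).2 hGconn.isPreconnected
  have hxU : Complex.equivRealProdCLM.symm x ∈ Complex.equivRealProdCLM ⁻¹' G := by
    simpa only [mem_preimage, ContinuousLinearEquiv.apply_symm_apply] using hx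
  have hbound : ∀ y ∈ G, |u y| ≤ |u x| := fun y hy => hxe ▸ hmax y (subset_closure hy)
  have hconst : ∀ y ∈ G, u y = u x := by
    intro y hy
    have hyU : Complex.equivRealProdCLM.symm y ∈ Complex.equivRealProdCLM ⁻¹' G := by
      simpa only [mem_preimage, ContinuousLinearEquiv.apply_symm_apply] using hy
    rcases le_total 0 (u x) with h | h
    · have := aux_max hUo hUc hharm hxU (fun w hw => by
        have h1 := hbound _ hw
        rw [abs_of_nonneg h] at h1
        simp only [Function.comp, ContinuousLinearEquiv.apply_symm_apply]
        exact (le_abs_self _).trans h1) _ hyU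
      simpa only [Function.comp, ContinuousLinearEquiv.apply_symm_apply] using this
    · have := aux_max hUo hUc hharm.neg hxU (fun w hw => by
        have h1 := hbound _ hw
        rw [abs_of_nonpos h] at h1
        simp only [Pi.neg_apply, Function.comp, ContinuousLinearEquiv.apply_symm_apply]
        exact (neg_le_abs _).trans h1) _ hyU
      simpa only [Pi.neg_apply, Function.comp, ContinuousLinearEquiv.apply_symm_apply,
        neg_inj] using this
  have hcl : EqOn u (fun _ => u x) (closure G) :=
    (show EqOn u (fun _ => u x) G from hconst).of_subset_closure hucont continuousOn_const
      subset_closure subset_rfl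
  have hg : u g₁ = u x := hcl (frontier_subset_closure hg₁)
  rw [huΓ₂ g₁ (by simp)] at hg
  rw [← hg, abs_zero] at hxe
  exact hne (abs_eq_zero.1 hxe.symm)
end
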